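/- Let f : ℝ^d → ℝ be convex and twice continuously differentiable with gradient g and Hessian H, bounded below with minimum value f_*, let Q = {x : f(x) ≤ f(x₀)}, suppose f is relatively convex on Q with constant μ̂ > 0, and suppose g(x) ∈ Range(H(x)) for all x. Then for every x ∈ Q: f_* ≥ f(x) − (1/(2μ̂))·⟨H(x)† g(x), g(x)⟩. -/

import Mathlib

open Matrix

/-- The four Moore–Penrose conditions characterizing the pseudoinverse. -/
def IsMoorePenrose {n : ℕ} (M Md : Matrix (Fin n) (Fin n) ℝ) : Prop :=
  M * Md * M = M ∧ Md * M * Md = Md ∧ (M * Md)ᵀ = M * Md ∧ (Md * M)ᵀ = Md * M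

theorem aux_sndDeriv {d : ℕ} (f : (Fin d → ℝ) → ℝ)
    (H : (Fin d → ℝ) → Matrix (Fin d) (Fin d) ℝ)
    (hf : ContDiff ℝ 2 f)
    (hH : ∀ x u v, fderiv ℝ (fun z => fderiv ℝ f z u) x v = u ⬝ᵥ (H x *ᵥ v)) (x u v) :
    fderiv ℝ (fderiv ℝ f) x v u = u ⬝ᵥ (H x *ᵥ v) := by
  have hd : Differentiable ℝ (fderiv ℝ f) :=
    (hf.fderiv_right (m := 1) (by norm_num)).differentiable (by norm_num)
  rw [← hH, fderiv_clm_apply (hd x) (differentiableAt_const u)]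
  simp

theorem aux_symm {d : ℕ} (f : (Fin d → ℝ) → ℝ)
    (H : (Fin d → ℝ) → Matrix (Fin d) (Fin d) ℝ)
    (hf : ContDiff ℝ 2 f)
    (hH : ∀ x u v, fderiv ℝ (fun z => fderiv ℝ f z u) x v = u ⬝ᵥ (H x *ᵥ v)) (x u v) :
    u ⬝ᵥ (H x *ᵥ v) = v ⬝ᵥ (H x *ᵥ u) := by
  rw [← aux_sndDeriv f H hf hH, ← aux_sndDeriv f H hf hH]
  exact (hf.contDiffAt.isSymmSndFDerivAt (by simp)).eq v u

theorem aux_psd {d : ℕ} (f : (Fin d → ℝ) → ℝ)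
    (H : (Fin d → ℝ) → Matrix (Fin d) (Fin d) ℝ)
    (hf : ContDiff ℝ 2 f) (hconv : ConvexOn ℝ Set.univ f)
    (hH : ∀ x u v, fderiv ℝ (fun z => fderiv ℝ f z u) x v = u ⬝ᵥ (H x *ᵥ v)) (x v) :
    0 ≤ v ⬝ᵥ (H x *ᵥ v) := by
  have hd : Differentiable ℝ (fderiv ℝ f) :=
    (hf.fderiv_right (m := 1) (by norm_num)).differentiable (by norm_num)
  have hl : ∀ t : ℝ, HasDerivAt (fun t : ℝ => x + t • v) v t := fun t => by
    simpa using ((hasDerivAt_id t).smul_const v).const_add x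
  have h1 : ∀ t : ℝ, HasDerivAt (fun t : ℝ => f (x + t • v)) (fderiv ℝ f (x + t • v) v) t :=
    fun t => ((hf.differentiable (by norm_num)) _).hasFDerivAt.comp_hasDerivAt t (hl t)
  have hc : ConvexOn ℝ Set.univ (fun t : ℝ => f (x + t • v)) := by
    refine ⟨convex_univ, fun a _ b _ p q hp hq hpq => ?_⟩
    have := hconv.2 (Set.mem_univ (x + a • v)) (Set.mem_univ (x + b • v)) hp hq hpq
    have e : x + (p • a + q • b) • v = p • (x + a • v) + q • (x + b • v) := by
      obtain rfl : q = 1 - p := by linarith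
      simp only [smul_eq_mul]
      module
    simpa only [e] using this
  have hm := hc.monotoneOn_deriv (fun t _ => (h1 t).differentiableAt)
  have e : deriv (fun t : ℝ => f (x + t • v)) = fun t => fderiv ℝ f (x + t • v) v :=
    funext fun t => (h1 t).deriv
  rw [e] at hm
  have h2 : HasDerivAt (fun t : ℝ => fderiv ℝ f (x + t • v) v) (v ⬝ᵥ (H x *ᵥ v)) 0 := by
    have h3 : DifferentiableAt ℝ (fun z => fderiv ℝ f z v) (x + (0:ℝ) • v) :=
      (hd _).clm_apply (differentiableAt_const v)
    have := h3.hasFDerivAt.comp_hasDerivAt (0:ℝ) (hl 0)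
    rw [hH] at this
    simpa [Function.comp_def] using this
  have h4 := hm.derivWithin_nonneg (x := 0)
  rwa [derivWithin_univ, h2.deriv] at h4

/-- For a convex C² function `f`, bounded below with infimum
`f_*`, relatively convex on the level set `Q = {x : f(x) ≤ f(x₀)}` with constant
`μ̂ > 0`, and with `g(x) ∈ Range(H(x))` everywhere, one has for every `x ∈ Q`:
`f_* ≥ f(x) − (1/(2μ̂))⟨H(x)†g(x), g(x)⟩`. -/
theorem stmt11 {d : ℕ} (f : (Fin d → ℝ) → ℝ)
    (g : (Fin d → ℝ) → (Fin d → ℝ))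
    (H : (Fin d → ℝ) → Matrix (Fin d) (Fin d) ℝ)
    (hf : ContDiff ℝ 2 f) (hconv : ConvexOn ℝ Set.univ f)
    (hg : ∀ x v, fderiv ℝ f x v = g x ⬝ᵥ v)
    (hH : ∀ x u v, fderiv ℝ (fun z => fderiv ℝ f z u) x v = u ⬝ᵥ (H x *ᵥ v))
    (fstar : ℝ) (hfstar : IsGLB (Set.range f) fstar)
    (x₀ : Fin d → ℝ) (Q : Set (Fin d → ℝ)) (hQ : Q = {x | f x ≤ f x₀})
    (μhat : ℝ) (hμhat : 0 < μhat)
    (hrelconv : ∀ x ∈ Q, ∀ y ∈ Q,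
      f y + g y ⬝ᵥ (x - y) + (μhat / 2) * ((H y *ᵥ (x - y)) ⬝ᵥ (x - y)) ≤ f x)
    (hrange : ∀ x, g x ∈ LinearMap.range (H x).mulVecLin)
    (Hdag : (Fin d → ℝ) → Matrix (Fin d) (Fin d) ℝ)
    (hdag : ∀ x, IsMoorePenrose (H x) (Hdag x)) :
    ∀ x ∈ Q, f x - (1 / (2 * μhat)) * ((Hdag x *ᵥ g x) ⬝ᵥ g x) ≤ fstar := by
  intro x hx
  obtain ⟨w, hw⟩ := hrange x
  rw [Matrix.mulVecLin_apply] at hw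
  have hsym := aux_symm f H hf hH x
  have hpsd := aux_psd f H hf hconv hH x
  have key : (Hdag x *ᵥ g x) ⬝ᵥ g x = w ⬝ᵥ (H x *ᵥ w) := by
    rw [← hw, hsym, Matrix.mulVec_mulVec, Matrix.mulVec_mulVec, (hdag x).1]
  have main : ∀ y ∈ Q, f x - (1 / (2 * μhat)) * ((Hdag x *ᵥ g x) ⬝ᵥ g x) ≤ f y := by
    intro y hy
    have h1 := hrelconv y hy x hx
    rw [key]
    generalize y - x = h at h1
    have h2 := hpsd (w + μhat • h)
    have h3 := hsym w h
    have h4 : g x ⬝ᵥ h = h ⬝ᵥ (H x *ᵥ w) := by rw [← hw, dotProduct_comm]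
    have h5 : (H x *ᵥ h) ⬝ᵥ h = h ⬝ᵥ (H x *ᵥ h) := dotProduct_comm _ _
    simp only [Matrix.mulVec_add, Matrix.mulVec_smul, add_dotProduct, dotProduct_add,
      smul_dotProduct, dotProduct_smul, smul_eq_mul] at h2
    rw [h3] at h2
    rw [h4, h5] at h1
    generalize h ⬝ᵥ (H x *ᵥ w) = b at *
    generalize h ⬝ᵥ (H x *ᵥ h) = c at *
    generalize w ⬝ᵥ (H x *ᵥ w) = a at *
    have h6 : 0 ≤ (1 / (2 * μhat)) * (a + μhat * b + μhat * (b + μhat * c)) :=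
      mul_nonneg (by positivity) (by linarith)
    have h7 : (1 / (2 * μhat)) * (a + μhat * b + μhat * (b + μhat * c))
        = (1 / (2 * μhat)) * a + b + μhat / 2 * c := by
      field_simp
      ring
    linarith
  refine hfstar.2 ?_
  rintro _ ⟨y, rfl⟩
  have h0 : x₀ ∈ Q := by rw [hQ]; exact le_refl (f x₀)
  by_cases hy : f y ≤ f x₀
  · exact main y (by rw [hQ]; exact hy)
  · exact (main x₀ h0).trans (not_le.mp hy).le
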